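/- arXiv:2208.00504 — 12 statements merged into one kernel-verified Lean document; each statement's English description precedes it below -/
import Mathlib

section
/- Let (Z_n)_{n≥0} be a sequence of positive real numbers satisfying the recursion inequality Z_{n+1} ≤ K b^n (Z_n^{1+μ₁} + Z_n^{1+μ₂}) for all n ≥ 0, where b > 1, K > 0 and μ₂ ≥ μ₁ > 0. If Z₀ ≤ min(1, (2K)^{-1/μ₁} b^{-1/μ₁²}), then there exists n₀ ∈ ℕ with Z_{n₀} ≤ 1, and Z_n → 0 as n → ∞. -/
open Real in
/-- If the sequence stays below the geometric envelope at index `n`, one step of the recursion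
contracts it by the factor `b ^ (-(1 / μ))`. -/
lemma superlinear_step_le {C b μ z₀ z : ℝ} {n : ℕ} (hb : 1 < b) (hC : 0 < C) (hμ : 0 < μ)
    (hz₀ : 0 < z₀) (hz₀C : z₀ ≤ C ^ (-(1 / μ)) * b ^ (-(1 / μ ^ 2)))
    (hz : 0 < z) (hzn : z ≤ z₀ * (b ^ (-(1 / μ))) ^ n) :
    C * b ^ n * z ^ (1 + μ) ≤ z * b ^ (-(1 / μ)) := by
  have hb0 : 0 < b := by positivity
  have hz₀μ : z₀ ^ μ ≤ C⁻¹ * b ^ (-(1 / μ)) := by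
    calc z₀ ^ μ ≤ (C ^ (-(1 / μ)) * b ^ (-(1 / μ ^ 2))) ^ μ := by gcongr
      _ = C⁻¹ * b ^ (-(1 / μ)) := by
        rw [mul_rpow (by positivity) (by positivity), ← rpow_mul hC.le, ← rpow_mul hb0.le,
          show -(1 / μ) * μ = -1 by field_simp, show -(1 / μ ^ 2) * μ = -(1 / μ) by field_simp,
          rpow_neg_one]
  have hrn : ((b ^ (-(1 / μ))) ^ n) ^ μ = (b ^ n)⁻¹ := by
    rw [← rpow_natCast, ← rpow_mul hb0.le, ← rpow_mul hb0.le,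
      show -(1 / μ) * n * μ = -(n : ℝ) by field_simp, rpow_neg hb0.le, rpow_natCast]
  have hzμ : z ^ μ ≤ C⁻¹ * b ^ (-(1 / μ)) * (b ^ n)⁻¹ := by
    calc z ^ μ ≤ (z₀ * (b ^ (-(1 / μ))) ^ n) ^ μ := by gcongr
      _ = z₀ ^ μ * (b ^ n)⁻¹ := by rw [mul_rpow hz₀.le (by positivity), hrn]
      _ ≤ C⁻¹ * b ^ (-(1 / μ)) * (b ^ n)⁻¹ := by gcongr
  calc C * b ^ n * z ^ (1 + μ) = C * b ^ n * z * z ^ μ := by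
        rw [rpow_add hz, rpow_one]; ring
    _ ≤ C * b ^ n * z * (C⁻¹ * b ^ (-(1 / μ)) * (b ^ n)⁻¹) := by gcongr
    _ = z * b ^ (-(1 / μ)) := by field_simp



/-- Geometric convergence lemma (Ho–Sim): one-step recursion, first smallness condition. -/
theorem stmt_0 (Z : ℕ → ℝ) (K b μ₁ μ₂ : ℝ)
    (hZpos : ∀ n, 0 < Z n) (hb : 1 < b) (hK : 0 < K)
    (hμ₁ : 0 < μ₁) (hμ₁₂ : μ₁ ≤ μ₂)
    (hrec : ∀ n : ℕ, Z (n + 1) ≤ K * b ^ n * (Z n ^ (1 + μ₁) + Z n ^ (1 + μ₂)))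
    (hZ0 : Z 0 ≤ min 1 ((2 * K) ^ (-(1 / μ₁)) * b ^ (-(1 / μ₁ ^ 2)))) :
    (∃ n₀ : ℕ, Z n₀ ≤ 1) ∧ Filter.Tendsto Z Filter.atTop (nhds 0) := by
  obtain ⟨hZ0_one, hZ0_small⟩ := le_min_iff.mp hZ0
  have hr_nonneg : 0 ≤ b ^ (-(1 / μ₁)) := by positivity
  have hr_lt : b ^ (-(1 / μ₁)) < 1 :=
    Real.rpow_lt_one_of_one_lt_of_neg hb (neg_lt_zero.mpr (by positivity))
  have hdecay (n : ℕ) : Z n ≤ Z 0 * (b ^ (-(1 / μ₁))) ^ n := by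
    induction n with
    | zero => simp
    | succ n ih =>
      have hZn : Z n ≤ 1 :=
        ih.trans (mul_le_one₀ hZ0_one (by positivity) (pow_le_one₀ hr_nonneg hr_lt.le))
      have hexp : Z n ^ (1 + μ₂) ≤ Z n ^ (1 + μ₁) :=
        Real.rpow_le_rpow_of_exponent_ge (hZpos n) hZn (by linarith)
      calc Z (n + 1) ≤ K * b ^ n * (Z n ^ (1 + μ₁) + Z n ^ (1 + μ₂)) := hrec n
        _ ≤ K * b ^ n * (Z n ^ (1 + μ₁) + Z n ^ (1 + μ₁)) := by gcongr
        _ = 2 * K * b ^ n * Z n ^ (1 + μ₁) := by ring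
        _ ≤ Z n * b ^ (-(1 / μ₁)) :=
          superlinear_step_le hb (by positivity) hμ₁ (hZpos 0) hZ0_small (hZpos n) ih
        _ ≤ Z 0 * (b ^ (-(1 / μ₁))) ^ n * b ^ (-(1 / μ₁)) := by gcongr
        _ = Z 0 * (b ^ (-(1 / μ₁))) ^ (n + 1) := by ring
  refine ⟨⟨0, hZ0_one⟩, squeeze_zero (fun n => (hZpos n).le) hdecay ?_⟩
  simpa using (tendsto_pow_atTop_nhds_zero_of_lt_one hr_nonneg hr_lt).const_mul (Z 0)
end

section
/- Let (Z_n)_{n≥0} be a sequence of positive real numbers satisfying the recursion inequality Z_{n+1} ≤ K b^n (Z_n^{1+μ₁} + Z_n^{1+μ₂}) for all n ≥ 0, where b > 1, K > 0 and μ₂ ≥ μ₁ > 0. If Z₀ ≤ min((2K)^{-1/μ₁} b^{-1/μ₁²}, (2K)^{-1/μ₂} b^{-1/(μ₁μ₂) - (μ₂-μ₁)/μ₂²}), then there exists n₀ ∈ ℕ with Z_{n₀} ≤ 1, and Z_n → 0 as n → ∞. -/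
/-- If `x ≤ M q ^ n` with `b q ^ μ ≤ 1`, then the geometric factor `b ^ n` is absorbed by `x ^ μ`. -/
lemma pow_mul_rpow_le_rpow_of_le_geometric {x M q b μ : ℝ} {n : ℕ} (hx : 0 ≤ x) (hM : 0 ≤ M)
    (hq : 0 ≤ q) (hb : 0 ≤ b) (hμ : 0 ≤ μ) (hxM : x ≤ M * q ^ n) (hbq : b * q ^ μ ≤ 1) :
    b ^ n * x ^ μ ≤ M ^ μ := by
  have hpow : (q ^ n) ^ μ = (q ^ μ) ^ n := by
    rw [← Real.rpow_natCast_mul hq, mul_comm, Real.rpow_mul_natCast hq]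
  calc b ^ n * x ^ μ ≤ b ^ n * (M * q ^ n) ^ μ := by gcongr
    _ = M ^ μ * (b * q ^ μ) ^ n := by
      rw [Real.mul_rpow hM (pow_nonneg hq n), hpow, mul_pow]
      ring
    _ ≤ M ^ μ := mul_le_of_le_one_right (by positivity) (pow_le_one₀ (by positivity) hbq)

/-- The recursion `Z (n + 1) ≤ K b ^ n (Z n ^ (1 + μ₁) + Z n ^ (1 + μ₂))` forces geometric decay of
rate `q` as soon as `2 K Z 0 ^ μᵢ ≤ q` and `b q ^ μᵢ ≤ 1`. -/
lemma le_geometric_of_superlinear_recursion {Z : ℕ → ℝ} {K b q μ₁ μ₂ : ℝ}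
    (hZpos : ∀ n, 0 < Z n) (hb : 0 ≤ b) (hK : 0 ≤ K) (hq : 0 ≤ q) (hμ₁ : 0 ≤ μ₁) (hμ₂ : 0 ≤ μ₂)
    (hrec : ∀ n : ℕ, Z (n + 1) ≤ K * b ^ n * (Z n ^ (1 + μ₁) + Z n ^ (1 + μ₂)))
    (hZ₁ : 2 * K * Z 0 ^ μ₁ ≤ q) (hZ₂ : 2 * K * Z 0 ^ μ₂ ≤ q)
    (hq₁ : b * q ^ μ₁ ≤ 1) (hq₂ : b * q ^ μ₂ ≤ 1) (n : ℕ) : Z n ≤ Z 0 * q ^ n := by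
  induction n with
  | zero => simp
  | succ n ih =>
    have h₁ := pow_mul_rpow_le_rpow_of_le_geometric (hZpos n).le (hZpos 0).le hq hb hμ₁ ih hq₁
    have h₂ := pow_mul_rpow_le_rpow_of_le_geometric (hZpos n).le (hZpos 0).le hq hb hμ₂ ih hq₂
    calc Z (n + 1) ≤ K * b ^ n * (Z n ^ (1 + μ₁) + Z n ^ (1 + μ₂)) := hrec n
      _ = Z n * (K * (b ^ n * Z n ^ μ₁ + b ^ n * Z n ^ μ₂)) := by
        rw [Real.rpow_add (hZpos n), Real.rpow_add (hZpos n), Real.rpow_one]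
        ring
      _ ≤ Z n * (K * (Z 0 ^ μ₁ + Z 0 ^ μ₂)) := by
        have := (hZpos n).le
        gcongr
      _ ≤ Z n * q := mul_le_mul_of_nonneg_left (by linarith) (hZpos n).le
      _ ≤ Z 0 * q ^ n * q := by gcongr
      _ = Z 0 * q ^ (n + 1) := by ring

lemma mul_rpow_le_of_le_rpow_mul_rpow {x A b μ e r : ℝ} (hx : 0 ≤ x) (hA : 0 < A) (hb : 1 ≤ b)
    (hμ : 0 < μ) (hxA : x ≤ A ^ (-(1 / μ)) * b ^ e) (he : e * μ ≤ r) :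
    A * x ^ μ ≤ b ^ r := by
  have hb₀ : 0 ≤ b := by linarith
  calc A * x ^ μ ≤ A * (A ^ (-(1 / μ)) * b ^ e) ^ μ := by gcongr
    _ = b ^ (e * μ) := by
      rw [Real.mul_rpow (by positivity) (by positivity), ← Real.rpow_mul hA.le,
        ← Real.rpow_mul hb₀, neg_mul, one_div_mul_cancel hμ.ne', Real.rpow_neg_one,
        mul_inv_cancel_left₀ hA.ne']
    _ ≤ b ^ r := Real.rpow_le_rpow_of_exponent_le hb he


/-- Geometric convergence lemma (Ho–Sim): one-step recursion, second smallness condition. -/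
theorem stmt_1 (Z : ℕ → ℝ) (K b μ₁ μ₂ : ℝ)
    (hZpos : ∀ n, 0 < Z n) (hb : 1 < b) (hK : 0 < K)
    (hμ₁ : 0 < μ₁) (hμ₁₂ : μ₁ ≤ μ₂)
    (hrec : ∀ n : ℕ, Z (n + 1) ≤ K * b ^ n * (Z n ^ (1 + μ₁) + Z n ^ (1 + μ₂)))
    (hZ0 : Z 0 ≤ min ((2 * K) ^ (-(1 / μ₁)) * b ^ (-(1 / μ₁ ^ 2)))
        ((2 * K) ^ (-(1 / μ₂)) * b ^ (-(1 / (μ₁ * μ₂)) - (μ₂ - μ₁) / μ₂ ^ 2))) :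
    (∃ n₀ : ℕ, Z n₀ ≤ 1) ∧ Filter.Tendsto Z Filter.atTop (nhds 0) := by
  have hb₀ : 0 < b := by linarith
  have hμ₂ : 0 < μ₂ := hμ₁.trans_le hμ₁₂
  set q : ℝ := b ^ (-(1 / μ₁)) with hq
  have hq₀ : 0 ≤ q := by positivity
  have hq_lt : q < 1 := Real.rpow_lt_one_of_one_lt_of_neg hb (by simpa using hμ₁)
  have hq₁ : b * q ^ μ₁ = 1 := by
    rw [hq, ← Real.rpow_mul hb₀.le, neg_mul, one_div_mul_cancel hμ₁.ne', Real.rpow_neg_one,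
      mul_inv_cancel₀ hb₀.ne']
  have hq₂ : b * q ^ μ₂ ≤ 1 := by
    rw [← hq₁]
    exact mul_le_mul_of_nonneg_left
      (Real.rpow_le_rpow_of_exponent_ge (by positivity) hq_lt.le hμ₁₂) hb₀.le
  have hZ₁ : 2 * K * Z 0 ^ μ₁ ≤ q :=
    mul_rpow_le_of_le_rpow_mul_rpow (hZpos 0).le (by positivity) hb.le hμ₁
      (hZ0.trans (min_le_left _ _)) (le_of_eq (by field_simp))
  have hZ₂ : 2 * K * Z 0 ^ μ₂ ≤ q := by
    refine mul_rpow_le_of_le_rpow_mul_rpow (hZpos 0).le (by positivity) hb.le hμ₂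
      (hZ0.trans (min_le_right _ _)) ?_
    have hsub : 0 ≤ (μ₂ - μ₁) / μ₂ := div_nonneg (by linarith) hμ₂.le
    have hexp : (-(1 / (μ₁ * μ₂)) - (μ₂ - μ₁) / μ₂ ^ 2) * μ₂ = -(1 / μ₁) - (μ₂ - μ₁) / μ₂ := by
      field_simp
    linarith
  have hgeom := le_geometric_of_superlinear_recursion hZpos hb₀.le hK.le hq₀ hμ₁.le hμ₂.le hrec
    hZ₁ hZ₂ hq₁.le hq₂
  have hlim : Filter.Tendsto Z Filter.atTop (nhds 0) := by
    refine squeeze_zero (fun n => (hZpos n).le) hgeom ?_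
    simpa using (tendsto_pow_atTop_nhds_zero_of_lt_one hq₀ hq_lt).const_mul (Z 0)
  exact ⟨(hlim.eventually_le_const zero_lt_one).exists, hlim⟩
end

section
/- Let (Z_n)_{n≥0} be a sequence of positive real numbers satisfying the recursion inequality Z_{n+1} ≤ K b^n (Z_n^{1+μ₁} + Z_n^{1+μ₂}) for all n ≥ 0, where b > 1, K > 0 and μ₂ ≥ μ₁ > 0, and suppose Z₀ ≤ min(1, (2K)^{-1/μ₁} b^{-1/μ₁²}). Let n₀ be the smallest nonnegative integer n with Z_n ≤ 1. Then Z_n ≤ min(1, (2K)^{-1/μ₁} b^{-1/μ₁²} b^{-n/μ₁}) for all n ≥ n₀. -/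
/-- The comparison sequence is chosen so that the growth factor `2 K b ^ n z ^ μ` of the recursion
contracts by exactly `b ^ (-(1 / μ))`. -/
theorem two_mul_mul_pow_mul_rpow_barrier {K b μ : ℝ} (hK : 0 < K) (hb : 0 < b) (hμ : μ ≠ 0)
    (n : ℕ) :
    2 * K * b ^ n * ((2 * K) ^ (-(1 / μ)) * b ^ (-(1 / μ ^ 2)) * b ^ (-((n : ℝ) / μ))) ^ μ
      = b ^ (-(1 / μ)) := by
  have hK2 : (0 : ℝ) < 2 * K := by positivity
  rw [Real.mul_rpow (by positivity) (by positivity), Real.mul_rpow (by positivity) (by positivity),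
    ← Real.rpow_mul hK2.le, ← Real.rpow_mul hb.le, ← Real.rpow_mul hb.le]
  have e₁ : -(1 / μ) * μ = -1 := by field_simp
  have e₂ : -(1 / μ ^ 2) * μ = -(1 / μ) := by field_simp
  have e₃ : -((n : ℝ) / μ) * μ = -(n : ℝ) := by field_simp
  rw [e₁, e₂, e₃, Real.rpow_neg_one, Real.rpow_neg hb.le (n : ℝ), Real.rpow_natCast]
  field_simp

/-- On `(0, 1]` the smaller exponent dominates, which reduces the recursion to a single power. -/
theorem rpow_add_rpow_le_two_mul {z μ₁ μ₂ : ℝ} (hz : 0 < z) (hz₁ : z ≤ 1) (hμ : μ₁ ≤ μ₂) :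
    z ^ (1 + μ₁) + z ^ (1 + μ₂) ≤ 2 * (z * z ^ μ₁) := by
  have h := Real.rpow_le_rpow_of_exponent_ge hz hz₁ (add_le_add_right hμ 1)
  have e : z ^ (1 + μ₁) = z * z ^ μ₁ := by rw [Real.rpow_add hz, Real.rpow_one]
  linarith


/-- Geometric convergence lemma (Ho–Sim): quantitative decay beyond the first index
where the sequence drops below `1`. -/
theorem stmt_2 (Z : ℕ → ℝ) (K b μ₁ μ₂ : ℝ)
    (hZpos : ∀ n, 0 < Z n) (hb : 1 < b) (hK : 0 < K)
    (hμ₁ : 0 < μ₁) (hμ₁₂ : μ₁ ≤ μ₂)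
    (hrec : ∀ n : ℕ, Z (n + 1) ≤ K * b ^ n * (Z n ^ (1 + μ₁) + Z n ^ (1 + μ₂)))
    (hZ0 : Z 0 ≤ min 1 ((2 * K) ^ (-(1 / μ₁)) * b ^ (-(1 / μ₁ ^ 2))))
    (n₀ : ℕ) (hn₀ : Z n₀ ≤ 1) (hn₀min : ∀ m : ℕ, m < n₀ → 1 < Z m) :
    ∀ n : ℕ, n₀ ≤ n →
      Z n ≤ min 1 ((2 * K) ^ (-(1 / μ₁)) * b ^ (-(1 / μ₁ ^ 2)) * b ^ (-((n : ℝ) / μ₁))) := by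
  suffices h : ∀ n : ℕ,
      Z n ≤ min 1 ((2 * K) ^ (-(1 / μ₁)) * b ^ (-(1 / μ₁ ^ 2)) * b ^ (-((n : ℝ) / μ₁))) from
    fun n _ => h n
  have hb₀ : 0 < b := one_pos.trans hb
  intro n
  induction n with
  | zero => simpa using hZ0
  | succ n ih =>
    obtain ⟨hle_one, hle⟩ := le_min_iff.1 ih
    have hstep : Z (n + 1) ≤ Z n * b ^ (-(1 / μ₁)) := calc
      Z (n + 1) ≤ K * b ^ n * (2 * (Z n * Z n ^ μ₁)) :=
        (hrec n).trans <| mul_le_mul_of_nonneg_left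
          (rpow_add_rpow_le_two_mul (hZpos n) hle_one hμ₁₂) (by positivity)
      _ = Z n * (2 * K * b ^ n * Z n ^ μ₁) := by ring
      _ ≤ Z n * b ^ (-(1 / μ₁)) := by
        rw [← two_mul_mul_pow_mul_rpow_barrier hK hb₀ hμ₁.ne' n]
        exact mul_le_mul_of_nonneg_left (mul_le_mul_of_nonneg_left
          (Real.rpow_le_rpow (hZpos n).le hle hμ₁.le) (by positivity)) (hZpos n).le
    refine le_min ?_ ?_
    · have hcontr : b ^ (-(1 / μ₁)) ≤ 1 :=
        Real.rpow_le_one_of_one_le_of_nonpos hb.le (by simpa using hμ₁.le)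
      exact hstep.trans (mul_le_one₀ hle_one (by positivity) hcontr)
    · refine (hstep.trans (mul_le_mul_of_nonneg_right hle (by positivity))).trans_eq ?_
      rw [mul_assoc, ← Real.rpow_add hb₀]
      congr 2
      push_cast
      ring
end

section
/- Let (Z_n)_{n≥0} be a sequence of positive real numbers satisfying the two-step recursion inequality Z_{n+1} ≤ K b^n (Z_{n-1}^{1+μ₁} + Z_{n-1}^{1+μ₂}) for all n ≥ 1, where b > 1, K > 0 and μ₂ ≥ μ₁ > 0. If max(Z₀, Z₁) ≤ min(1, (2b²K)^{-1/μ₁} (b²)^{-1/μ₁²}, (2b²K)^{-1/μ₂} (b²)^{-1/(μ₁μ₂) - (μ₂-μ₁)/μ₂²}), then Z_n → 0 as n → ∞. -/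
/-- Geometric convergence: a sequence satisfying a superlinear recursion inequality with
geometrically growing coefficients decays geometrically once its first term is small. -/
theorem le_geometric_of_superlinear_rec (Y : ℕ → ℝ) (C B μ₁ μ₂ : ℝ)
    (hY : ∀ n, 0 < Y n) (hB : 1 < B) (hC : 0 < C) (hμ₁ : 0 < μ₁) (hμ₁₂ : μ₁ ≤ μ₂)
    (hrec : ∀ n, Y (n + 1) ≤ C * B ^ n * (Y n ^ (1 + μ₁) + Y n ^ (1 + μ₂)))
    (h1 : Y 0 ≤ 1) (h0 : Y 0 ≤ (2 * C) ^ (-(1 / μ₁)) * B ^ (-(1 / μ₁ ^ 2))) (n : ℕ) :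
    Y n ≤ Y 0 * (B ^ (-(1 / μ₁))) ^ n := by
  have hB0 : 0 < B := by linarith
  set r : ℝ := B ^ (-(1 / μ₁)) with hr
  have hr0 : 0 < r := by positivity
  have hr1 : r ≤ 1 := Real.rpow_le_one_of_one_le_of_nonpos hB.le (by simp [hμ₁.le])
  have hrμ : r ^ μ₁ = B⁻¹ := by
    rw [hr, ← Real.rpow_mul hB0.le, show -(1 / μ₁) * μ₁ = -1 by field_simp, Real.rpow_neg_one]
  have hM : Y 0 ^ μ₁ ≤ (2 * C)⁻¹ * r := by
    calc Y 0 ^ μ₁ ≤ ((2 * C) ^ (-(1 / μ₁)) * B ^ (-(1 / μ₁ ^ 2))) ^ μ₁ :=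
          Real.rpow_le_rpow (hY 0).le h0 hμ₁.le
      _ = (2 * C)⁻¹ * r := by
          rw [Real.mul_rpow (by positivity) (by positivity), ← Real.rpow_mul (by positivity),
            ← Real.rpow_mul hB0.le, show -(1 / μ₁) * μ₁ = -1 by field_simp, Real.rpow_neg_one,
            show -(1 / μ₁ ^ 2) * μ₁ = -(1 / μ₁) by field_simp]
  induction n with
  | zero => simp
  | succ n ih =>
    have hn1 : Y n ≤ 1 :=
      ih.trans (mul_le_one₀ h1 (by positivity) (pow_le_one₀ hr0.le hr1))
    have hexp : Y n ^ (1 + μ₂) ≤ Y n ^ (1 + μ₁) :=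
      Real.rpow_le_rpow_of_exponent_ge (hY n) hn1 (by linarith)
    have hpow : Y n ^ μ₁ ≤ (2 * C)⁻¹ * r * B⁻¹ ^ n := by
      calc Y n ^ μ₁ ≤ (Y 0 * r ^ n) ^ μ₁ := Real.rpow_le_rpow (hY n).le ih hμ₁.le
        _ = Y 0 ^ μ₁ * B⁻¹ ^ n := by
          rw [Real.mul_rpow (hY 0).le (by positivity), ← Real.rpow_pow_comm hr0.le, hrμ]
        _ ≤ _ := by gcongr
    calc Y (n + 1) ≤ C * B ^ n * (Y n ^ (1 + μ₁) + Y n ^ (1 + μ₂)) := hrec n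
      _ ≤ C * B ^ n * (Y n ^ (1 + μ₁) + Y n ^ (1 + μ₁)) := by gcongr
      _ = 2 * C * B ^ n * Y n * Y n ^ μ₁ := by
        rw [Real.rpow_add (hY n), Real.rpow_one]; ring
      _ ≤ 2 * C * B ^ n * Y n * ((2 * C)⁻¹ * r * B⁻¹ ^ n) := by
        have := hY n
        gcongr
      _ = Y n * r := by rw [inv_pow]; field_simp
      _ ≤ Y 0 * r ^ n * r := by gcongr
      _ = Y 0 * r ^ (n + 1) := by ring

/-- Two-step version of the geometric convergence recursion lemma. -/
theorem stmt_3 (Z : ℕ → ℝ) (K b μ₁ μ₂ : ℝ)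
    (hZpos : ∀ n, 0 < Z n) (hb : 1 < b) (hK : 0 < K)
    (hμ₁ : 0 < μ₁) (hμ₁₂ : μ₁ ≤ μ₂)
    (hrec : ∀ n : ℕ, 1 ≤ n →
      Z (n + 1) ≤ K * b ^ n * (Z (n - 1) ^ (1 + μ₁) + Z (n - 1) ^ (1 + μ₂)))
    (hZ01 : max (Z 0) (Z 1) ≤
      min 1 (min ((2 * b ^ 2 * K) ^ (-(1 / μ₁)) * (b ^ 2) ^ (-(1 / μ₁ ^ 2)))
        ((2 * b ^ 2 * K) ^ (-(1 / μ₂)) *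
          (b ^ 2) ^ (-(1 / (μ₁ * μ₂)) - (μ₂ - μ₁) / μ₂ ^ 2)))) :
    Filter.Tendsto Z Filter.atTop (nhds 0) := by
  have hB : 1 < b ^ 2 := one_lt_pow₀ hb two_ne_zero
  have hsub : ∀ i ≤ 1, ∀ k, Z (2 * k + i) ≤ ((b ^ 2) ^ (-(1 / μ₁))) ^ k := by
    intro i hi k
    have hi0 : Z i ≤ max (Z 0) (Z 1) := by
      interval_cases i
      · exact le_max_left _ _
      · exact le_max_right _ _
    have hi1 := le_min_iff.1 (hi0.trans hZ01)
    have hi2 := (le_min_iff.1 hi1.2).1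
    have hstep : ∀ n, Z (2 * (n + 1) + i) ≤ b ^ 2 * K * (b ^ 2) ^ n *
        (Z (2 * n + i) ^ (1 + μ₁) + Z (2 * n + i) ^ (1 + μ₂)) := by
      intro n
      have hZn := hZpos (2 * n + i)
      calc Z (2 * (n + 1) + i) ≤ K * b ^ (2 * n + i + 1) *
            (Z (2 * n + i) ^ (1 + μ₁) + Z (2 * n + i) ^ (1 + μ₂)) := by
            have h := hrec (2 * n + i + 1) (by omega)
            rwa [Nat.add_sub_cancel, show 2 * n + i + 1 + 1 = 2 * (n + 1) + i by ring] at h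
        _ ≤ K * b ^ (2 * n + 2) *
            (Z (2 * n + i) ^ (1 + μ₁) + Z (2 * n + i) ^ (1 + μ₂)) := by
            have hpow : b ^ (2 * n + i + 1) ≤ b ^ (2 * n + 2) :=
              pow_le_pow_right₀ hb.le (by omega)
            gcongr K * ?_ * _
        _ = _ := by ring
    have h := le_geometric_of_superlinear_rec (fun k => Z (2 * k + i)) (b ^ 2 * K) (b ^ 2) μ₁ μ₂
      (fun _ => hZpos _) hB (by positivity) hμ₁ hμ₁₂ hstep (by simpa using hi1.1)
      (by simpa [mul_assoc] using hi2) k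
    refine h.trans (mul_le_of_le_one_left (by positivity) ?_)
    simpa using hi1.1
  have hr1 : (b ^ 2) ^ (-(1 / μ₁)) < 1 :=
    Real.rpow_lt_one_of_one_lt_of_neg hB (by simpa using hμ₁)
  have hlim := (tendsto_pow_atTop_nhds_zero_of_lt_one (by positivity) hr1).comp
    (Nat.tendsto_div_const_atTop two_ne_zero)
  refine squeeze_zero (fun n => (hZpos n).le) (fun n => ?_) hlim
  have h := hsub (n % 2) (by omega) (n / 2)
  rwa [Nat.div_add_mod] at h
end

section
/- Let B ⊂ ℝ^N be a bounded open set, let α, β be real constants with 1 ≤ α ≤ β < ∞, let w : B → [0,∞) be integrable, and set φ(x,t) = t^α + w(x) t^β with Luxemburg norm ‖v‖_φ = inf{λ > 0 : ∫_B φ(x, |v(x)|/λ) dx ≤ 1}. Then for every measurable v : B → ℝ with ∫_B φ(x,|v|) dx < ∞, one has (1/2)[(∫_B |v|^α dx)^{1/α} + (∫_B w(x)|v|^β dx)^{1/β}] ≤ ‖v‖_φ ≤ 2^{1/α}[(∫_B |v|^α dx)^{1/α} + (∫_B w(x)|v|^β dx)^{1/β}]. -/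
open MeasureTheory

/-- The Luxemburg norm of the two-term modular `(a / t) ^ α + (b / t) ^ β` is comparable
to `a + b`. -/
lemma half_add_le_csInf_and_csInf_le {α β a b : ℝ} (hα : 1 ≤ α) (hαβ : α ≤ β)
    (ha : 0 ≤ a) (hb : 0 ≤ b) :
    1 / 2 * (a + b) ≤ sInf {t : ℝ | 0 < t ∧ (a / t) ^ α + (b / t) ^ β ≤ 1} ∧
      sInf {t : ℝ | 0 < t ∧ (a / t) ^ α + (b / t) ^ β ≤ 1} ≤ 2 ^ (1 / α) * (a + b) := by
  have hα0 : 0 < α := by linarith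
  have hβ0 : 0 < β := by linarith
  set S := {t : ℝ | 0 < t ∧ (a / t) ^ α + (b / t) ^ β ≤ 1}
  have hc : (0 : ℝ) < 2 ^ (1 / α) := by positivity
  have hmem : ∀ t, 2 ^ (1 / α) * (a + b) < t → t ∈ S := by
    intro t ht
    have ht0 : 0 < t := lt_of_le_of_lt (by positivity) ht
    have hbound : ∀ c, c ≤ a + b → c / t ≤ (1 / 2) ^ (1 / α) := by
      intro c hcab
      rw [Real.div_rpow zero_le_one zero_le_two, Real.one_rpow, div_le_div_iff₀ ht0 hc]
      nlinarith
    have h2 : (((1 : ℝ) / 2) ^ (1 / α)) ^ α = 1 / 2 := by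
      rw [one_div α, Real.rpow_inv_rpow (by norm_num) hα0.ne']
    have h1 : ((1 : ℝ) / 2) ^ (1 / α) ≤ 1 :=
      Real.rpow_le_one (by norm_num) (by norm_num) (by positivity)
    have hA : (a / t) ^ α ≤ 1 / 2 :=
      (Real.rpow_le_rpow (by positivity) (hbound a (by linarith)) hα0.le).trans_eq h2
    have hB : (b / t) ^ β ≤ 1 / 2 :=
      calc (b / t) ^ β ≤ (((1 : ℝ) / 2) ^ (1 / α)) ^ β :=
            Real.rpow_le_rpow (by positivity) (hbound b (by linarith)) hβ0.le
        _ ≤ (((1 : ℝ) / 2) ^ (1 / α)) ^ α :=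
            Real.rpow_le_rpow_of_exponent_ge (by positivity) h1 hαβ
        _ = 1 / 2 := h2
    exact ⟨ht0, by linarith⟩
  constructor
  · refine le_csInf ⟨_, hmem _ (lt_add_one _)⟩ ?_
    rintro t ⟨ht0, ht⟩
    have hle : ∀ {c p : ℝ}, 0 < p → (c / t) ^ p ≤ 1 → c ≤ t := by
      intro c p hp h
      by_contra! hlt
      exact h.not_gt (Real.one_lt_rpow ((one_lt_div ht0).2 hlt) hp)
    have hA : 0 ≤ (a / t) ^ α := by positivity
    have hB : 0 ≤ (b / t) ^ β := by positivity
    linarith [hle hα0 (by linarith), hle hβ0 (by linarith)]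
  · exact le_of_forall_gt_imp_ge_of_dense fun t ht =>
      csInf_le ⟨0, fun _ hs => hs.1.le⟩ (hmem t ht)

/-- Two-sided estimate of the Luxemburg norm of `φ(x,t) = t^α + w(x) t^β` in terms of the
weighted Lebesgue norms. -/
theorem stmt_7 (N : ℕ) (B : Set (Fin N → ℝ)) (hBo : IsOpen B) (hBb : Bornology.IsBounded B)
    (α β : ℝ) (hα : 1 ≤ α) (hαβ : α ≤ β)
    (w : (Fin N → ℝ) → ℝ) (hw0 : ∀ x, 0 ≤ w x) (hwint : IntegrableOn w B)
    (v : (Fin N → ℝ) → ℝ) (hv : Measurable v)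
    (hvint : IntegrableOn (fun x => |v x| ^ α + w x * |v x| ^ β) B)
    (nrm : ℝ)
    (hnrm : nrm = sInf {lam : ℝ | 0 < lam ∧
      (∫ x in B, ((|v x| / lam) ^ α + w x * (|v x| / lam) ^ β)) ≤ 1}) :
    (1 / 2) * ((∫ x in B, |v x| ^ α) ^ (1 / α) + (∫ x in B, w x * |v x| ^ β) ^ (1 / β)) ≤ nrm ∧
    nrm ≤ 2 ^ (1 / α) *
      ((∫ x in B, |v x| ^ α) ^ (1 / α) + (∫ x in B, w x * |v x| ^ β) ^ (1 / β)) := by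
  have hα0 : 0 < α := by linarith
  have hβ0 : 0 < β := by linarith
  have hA : IntegrableOn (fun x => |v x| ^ α) B := by
    refine Integrable.mono' hvint (hv.abs.pow_const α).aestronglyMeasurable
      (Filter.Eventually.of_forall fun x => ?_)
    have h1 : 0 ≤ |v x| ^ α := by positivity
    have h2 : 0 ≤ w x * |v x| ^ β := mul_nonneg (hw0 x) (by positivity)
    rw [Real.norm_of_nonneg h1]
    linarith
  have hW : IntegrableOn (fun x => w x * |v x| ^ β) B := by
    simpa [IntegrableOn, Pi.sub_def] using Integrable.sub hvint hA
  have hA0 : 0 ≤ ∫ x in B, |v x| ^ α := integral_nonneg fun x => by positivity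
  have hW0 : 0 ≤ ∫ x in B, w x * |v x| ^ β :=
    integral_nonneg fun x => mul_nonneg (hw0 x) (by positivity)
  have hmod : ∀ t : ℝ, 0 < t →
      ∫ x in B, ((|v x| / t) ^ α + w x * (|v x| / t) ^ β) =
        ((∫ x in B, |v x| ^ α) ^ (1 / α) / t) ^ α +
          ((∫ x in B, w x * |v x| ^ β) ^ (1 / β) / t) ^ β := by
    intro t ht
    rw [Real.div_rpow (by positivity) ht.le, Real.div_rpow (by positivity) ht.le,
      one_div, one_div, Real.rpow_inv_rpow hA0 hα0.ne', Real.rpow_inv_rpow hW0 hβ0.ne',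
      ← integral_div, ← integral_div, ← integral_add (hA.div_const _) (hW.div_const _)]
    refine integral_congr_ae (Filter.Eventually.of_forall fun x => ?_)
    simp only [Real.div_rpow (abs_nonneg (v x)) ht.le, mul_div_assoc]
  have hset : {lam : ℝ | 0 < lam ∧
      (∫ x in B, ((|v x| / lam) ^ α + w x * (|v x| / lam) ^ β)) ≤ 1} =
      {t : ℝ | 0 < t ∧ ((∫ x in B, |v x| ^ α) ^ (1 / α) / t) ^ α +
        ((∫ x in B, w x * |v x| ^ β) ^ (1 / β) / t) ^ β ≤ 1} := by
    ext t
    exact and_congr_right fun ht => by rw [hmod t ht]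
  rw [hnrm, hset]
  exact half_add_le_csInf_and_csInf_le hα hαβ (by positivity) (by positivity)
end

section
/- In the stated setting, g(s) ≤ p* · s^{1/p*} for all s ≥ 0, where p* = Np/(N−p). -/
/-- Estimate `g(s) ≤ p* s^{1/p*}` for the inverse of the Sobolev conjugate of
`h(t) = t^p + μ t^q`. -/
theorem stmt_8 (N : ℕ) (hN : 2 ≤ N) (p q μ : ℝ)
    (hp : 1 < p) (hpq : p < q) (hqN : q < (N : ℝ)) (hμ : 0 ≤ μ)
    (hinv : ℝ → ℝ)
    (hinv_left : ∀ t : ℝ, 0 ≤ t → hinv (t ^ p + μ * t ^ q) = t)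
    (hinv_right : ∀ s : ℝ, 0 ≤ s → 0 ≤ hinv s ∧ (hinv s) ^ p + μ * (hinv s) ^ q = s)
    (g : ℝ → ℝ)
    (hg : ∀ s : ℝ, g s = ∫ τ in (0 : ℝ)..s, hinv τ * τ ^ (-((N : ℝ) + 1) / N)) :
    ∀ s : ℝ, 0 ≤ s →
      g s ≤ ((N : ℝ) * p / ((N : ℝ) - p)) * s ^ (1 / ((N : ℝ) * p / ((N : ℝ) - p))) := by
  intro s hs
  have hp0 : 0 < p := by linarith
  have hN0 : (0 : ℝ) < N := by linarith
  have hNp : 0 < (N : ℝ) - p := by linarith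
  set a : ℝ := 1 / ((N : ℝ) * p / ((N : ℝ) - p)) with ha
  have ha0 : 0 < a := by positivity
  have hexp : a - 1 = 1 / p + -((N : ℝ) + 1) / N := by
    rw [ha]; field_simp; ring
  have hcoef : (N : ℝ) * p / ((N : ℝ) - p) = 1 / a := by rw [ha, one_div_one_div]
  have hint : IntervalIntegrable (fun τ : ℝ => τ ^ (a - 1)) MeasureTheory.volume 0 s :=
    intervalIntegral.intervalIntegrable_rpow' (by linarith)
  have hval : ∫ τ in (0 : ℝ)..s, τ ^ (a - 1) = 1 / a * s ^ a := by
    rw [integral_rpow (Or.inl (by linarith)), sub_add_cancel, Real.zero_rpow ha0.ne']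
    ring
  rw [hg s, hcoef, ← hval, intervalIntegral.integral_of_le hs, intervalIntegral.integral_of_le hs]
  refine MeasureTheory.integral_mono_of_nonneg ?_
    ((intervalIntegrable_iff_integrableOn_Ioc_of_le hs).1 hint) ?_
  · filter_upwards [MeasureTheory.ae_restrict_mem measurableSet_Ioc] with τ hτ
    exact mul_nonneg (hinv_right τ hτ.1.le).1 (Real.rpow_nonneg hτ.1.le _)
  · filter_upwards [MeasureTheory.ae_restrict_mem measurableSet_Ioc] with τ hτ
    obtain ⟨h0, h1⟩ := hinv_right τ hτ.1.le
    have hle : hinv τ ≤ τ ^ (1 / p) := by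
      rw [one_div, Real.le_rpow_inv_iff_of_pos h0 hτ.1.le hp0]
      linarith [mul_nonneg hμ (Real.rpow_nonneg h0 q)]
    rw [hexp, Real.rpow_add hτ.1]
    exact mul_le_mul_of_nonneg_right hle (Real.rpow_nonneg hτ.1.le _)
end

section
/- In the stated setting, if moreover μ > 0, then g(s) ≤ q* · μ^{-1/q} · s^{1/q*} for all s ≥ 0, where q* = Nq/(N−q). -/
open MeasureTheory

/-- A nonnegative `t` with `μ * t ^ q ≤ s` is at most `μ ^ (-(1 / q)) * s ^ (1 / q)`. -/
theorem le_rpow_of_mul_rpow_le {q μ t s : ℝ} (hq : 0 < q) (hμ : 0 < μ) (ht : 0 ≤ t)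
    (h : μ * t ^ q ≤ s) : t ≤ μ ^ (-(1 / q)) * s ^ (1 / q) := by
  have hs : 0 ≤ s := le_trans (by positivity) h
  have h1 : t ^ q ≤ μ⁻¹ * s := by
    rw [inv_mul_eq_div, le_div_iff₀ hμ]
    linarith
  calc t = (t ^ q) ^ (1 / q) := by rw [← Real.rpow_mul ht, mul_one_div_cancel hq.ne', Real.rpow_one]
    _ ≤ (μ⁻¹ * s) ^ (1 / q) := Real.rpow_le_rpow (by positivity) h1 (by positivity)
    _ = μ ^ (-(1 / q)) * s ^ (1 / q) := by
      rw [Real.mul_rpow (by positivity) hs, Real.inv_rpow hμ.le, Real.rpow_neg hμ.le]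


/-- Estimate `g(s) ≤ q* μ^{-1/q} s^{1/q*}` for the inverse of the Sobolev conjugate of
`h(t) = t^p + μ t^q` when `μ > 0`. -/
theorem stmt_9 (N : ℕ) (hN : 2 ≤ N) (p q μ : ℝ)
    (hp : 1 < p) (hpq : p < q) (hqN : q < (N : ℝ)) (hμ : 0 < μ)
    (hinv : ℝ → ℝ)
    (hinv_left : ∀ t : ℝ, 0 ≤ t → hinv (t ^ p + μ * t ^ q) = t)
    (hinv_right : ∀ s : ℝ, 0 ≤ s → 0 ≤ hinv s ∧ (hinv s) ^ p + μ * (hinv s) ^ q = s)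
    (g : ℝ → ℝ)
    (hg : ∀ s : ℝ, g s = ∫ τ in (0 : ℝ)..s, hinv τ * τ ^ (-((N : ℝ) + 1) / N)) :
    ∀ s : ℝ, 0 ≤ s →
      g s ≤ ((N : ℝ) * q / ((N : ℝ) - q)) * μ ^ (-(1 / q)) *
        s ^ (1 / ((N : ℝ) * q / ((N : ℝ) - q))) := by
  intro s hs
  have hq : 0 < q := by linarith
  have hN' : (0 : ℝ) < N := hq.trans hqN
  have hd : 0 < (N : ℝ) - q := sub_pos.2 hqN
  set r : ℝ := 1 / q + -((N : ℝ) + 1) / N with hr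
  have hr1 : r + 1 = 1 / ((N : ℝ) * q / ((N : ℝ) - q)) := by
    rw [hr]
    field_simp
    ring
  have hr0 : 0 < r + 1 := by
    rw [hr1]
    positivity
  have hint : IntervalIntegrable (fun τ : ℝ ↦ μ ^ (-(1 / q)) * τ ^ r) volume 0 s :=
    (intervalIntegral.intervalIntegrable_rpow' (by linarith)).const_mul _
  have hmono : g s ≤ ∫ τ in (0 : ℝ)..s, μ ^ (-(1 / q)) * τ ^ r := by
    rw [hg, intervalIntegral.integral_of_le hs, intervalIntegral.integral_of_le hs]
    refine integral_mono_of_nonneg ?_ ((intervalIntegrable_iff_integrableOn_Ioc_of_le hs).1 hint) ?_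
    · filter_upwards [ae_restrict_mem measurableSet_Ioc] with τ hτ
      exact mul_nonneg (hinv_right τ hτ.1.le).1 (Real.rpow_nonneg hτ.1.le _)
    · filter_upwards [ae_restrict_mem measurableSet_Ioc] with τ hτ
      obtain ⟨h0, h1⟩ := hinv_right τ hτ.1.le
      have hle : μ * hinv τ ^ q ≤ τ := by linarith [Real.rpow_nonneg h0 p]
      rw [hr, Real.rpow_add hτ.1, ← mul_assoc]
      exact mul_le_mul_of_nonneg_right (le_rpow_of_mul_rpow_le hq hμ h0 hle)
        (Real.rpow_nonneg hτ.1.le _)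
  refine hmono.trans_eq ?_
  rw [intervalIntegral.integral_const_mul, integral_rpow (Or.inl (by linarith)),
    Real.zero_rpow hr0.ne', sub_zero, hr1, div_div_eq_mul_div, div_one]
  ring
end

section
/- In the stated setting, for all s, t ≥ 0 with g(s) = t, one has t^{p*} + μ^{q*/q} · t^{q*} ≤ 2 (q*)^{q*} · s, where p* = Np/(N−p) and q* = Nq/(N−q). (In particular, the Sobolev conjugate H_* = g⁻¹ satisfies t^{p*} + μ^{q*/q} t^{q*} ≤ 2 (q*)^{q*} H_*(t) for all t ≥ 0.) -/
open MeasureTheory in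
/-- A power bound `c * f τ ^ r ≤ τ` integrates, against the Sobolev weight of dimension `n`, to a
bound by the critical power with exponent `n * r / (n - r)`. -/
theorem rpow_sobolev_integral_le {n r c s : ℝ} {f : ℝ → ℝ} (hr : 0 < r) (hrn : r < n)
    (hc : 0 ≤ c) (hs : 0 ≤ s) (hf : ∀ τ, 0 < τ → 0 ≤ f τ) (hcf : ∀ τ, 0 < τ → c * f τ ^ r ≤ τ)
    (ht : 0 ≤ ∫ τ in (0 : ℝ)..s, f τ * τ ^ (-(n + 1) / n)) :
    c ^ ((n * r / (n - r)) / r) *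
        (∫ τ in (0 : ℝ)..s, f τ * τ ^ (-(n + 1) / n)) ^ (n * r / (n - r)) ≤
      (n * r / (n - r)) ^ (n * r / (n - r)) * s := by
  have hn : 0 < n := hr.trans hrn
  have hnr : 0 < n - r := sub_pos.2 hrn
  set b := n * r / (n - r) with hb
  have hb0 : 0 < b := by positivity
  have hexp : r⁻¹ + -(n + 1) / n + 1 = b⁻¹ := by rw [hb]; field_simp; ring
  have hexp' : -1 < r⁻¹ + -(n + 1) / n := by linarith [inv_pos.2 hb0]
  have hpt : ∀ τ, 0 < τ → c ^ r⁻¹ * f τ ≤ τ ^ r⁻¹ := fun τ hτ => by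
    calc c ^ r⁻¹ * f τ = (c * f τ ^ r) ^ r⁻¹ := by
          rw [Real.mul_rpow hc (Real.rpow_nonneg (hf τ hτ) _),
            Real.rpow_rpow_inv (hf τ hτ) hr.ne']
      _ ≤ τ ^ r⁻¹ := Real.rpow_le_rpow
          (mul_nonneg hc (Real.rpow_nonneg (hf τ hτ) _)) (hcf τ hτ) (inv_pos.2 hr).le
  have hint : c ^ r⁻¹ * ∫ τ in (0 : ℝ)..s, f τ * τ ^ (-(n + 1) / n) ≤ b * s ^ b⁻¹ := by
    calc c ^ r⁻¹ * ∫ τ in (0 : ℝ)..s, f τ * τ ^ (-(n + 1) / n)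
        = ∫ τ in (0 : ℝ)..s, c ^ r⁻¹ * (f τ * τ ^ (-(n + 1) / n)) :=
          (intervalIntegral.integral_const_mul _ _).symm
      _ ≤ ∫ τ in (0 : ℝ)..s, τ ^ (r⁻¹ + -(n + 1) / n) := by
          have hi := (intervalIntegral.intervalIntegrable_rpow' (a := 0) (b := s) hexp').1
          rw [intervalIntegral.integral_of_le hs, intervalIntegral.integral_of_le hs]
          refine integral_mono_of_nonneg ?_ hi ?_
          · filter_upwards [ae_restrict_mem measurableSet_Ioc] with τ hτ
            exact mul_nonneg (Real.rpow_nonneg hc _)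
              (mul_nonneg (hf τ hτ.1) (Real.rpow_nonneg hτ.1.le _))
          · filter_upwards [ae_restrict_mem measurableSet_Ioc] with τ hτ
            rw [Real.rpow_add hτ.1, ← mul_assoc]
            exact mul_le_mul_of_nonneg_right (hpt τ hτ.1) (Real.rpow_nonneg hτ.1.le _)
      _ = b * s ^ b⁻¹ := by
          rw [integral_rpow (Or.inl hexp'), hexp, Real.zero_rpow (inv_pos.2 hb0).ne', sub_zero,
            div_inv_eq_mul, mul_comm]
  have hpow := Real.rpow_le_rpow (mul_nonneg (Real.rpow_nonneg hc _) ht) hint hb0.le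
  rwa [Real.mul_rpow (Real.rpow_nonneg hc _) ht, ← Real.rpow_mul hc,
    Real.mul_rpow hb0.le (Real.rpow_nonneg hs _), Real.rpow_inv_rpow hs hb0.ne',
    inv_mul_eq_div] at hpow

/-- The critical double phase integrand is controlled by the Sobolev conjugate function:
if `g(s) = t` then `t^{p*} + μ^{q*/q} t^{q*} ≤ 2 (q*)^{q*} s`. -/
theorem stmt_10 (N : ℕ) (hN : 2 ≤ N) (p q μ : ℝ)
    (hp : 1 < p) (hpq : p < q) (hqN : q < (N : ℝ)) (hμ : 0 ≤ μ)
    (hinv : ℝ → ℝ)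
    (hinv_left : ∀ t : ℝ, 0 ≤ t → hinv (t ^ p + μ * t ^ q) = t)
    (hinv_right : ∀ s : ℝ, 0 ≤ s → 0 ≤ hinv s ∧ (hinv s) ^ p + μ * (hinv s) ^ q = s)
    (g : ℝ → ℝ)
    (hg : ∀ s : ℝ, g s = ∫ τ in (0 : ℝ)..s, hinv τ * τ ^ (-((N : ℝ) + 1) / N)) :
    ∀ s t : ℝ, 0 ≤ s → 0 ≤ t → g s = t →
      t ^ ((N : ℝ) * p / ((N : ℝ) - p)) +
        μ ^ (((N : ℝ) * q / ((N : ℝ) - q)) / q) * t ^ ((N : ℝ) * q / ((N : ℝ) - q)) ≤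
      2 * ((N : ℝ) * q / ((N : ℝ) - q)) ^ ((N : ℝ) * q / ((N : ℝ) - q)) * s := by
  rintro s t hs ht rfl
  have hN0 : (0 : ℝ) < N := by linarith
  rw [hg] at ht ⊢
  have hnonneg : ∀ τ, 0 < τ → 0 ≤ hinv τ := fun τ hτ => (hinv_right τ hτ.le).1
  have hP := rpow_sobolev_integral_le (n := N) (r := p) (c := 1) (by linarith)
    (hpq.trans hqN) zero_le_one hs hnonneg
    (fun τ hτ => by
      linarith [(hinv_right τ hτ.le).2, mul_nonneg hμ (Real.rpow_nonneg (hnonneg τ hτ) q)]) ht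
  have hQ := rpow_sobolev_integral_le (n := N) (r := q) (c := μ) (by linarith)
    hqN hμ hs hnonneg
    (fun τ hτ => by linarith [(hinv_right τ hτ.le).2, Real.rpow_nonneg (hnonneg τ hτ) p]) ht
  rw [Real.one_rpow, one_mul] at hP
  have hp1 : 1 ≤ (N : ℝ) * p / (N - p) := by
    rw [one_le_div (by linarith)]
    nlinarith
  have hle : (N : ℝ) * p / (N - p) ≤ N * q / (N - q) :=
    div_le_div₀ (by nlinarith) (by nlinarith) (by linarith) (by linarith)
  have hconst : ((N : ℝ) * p / (N - p)) ^ ((N : ℝ) * p / (N - p)) ≤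
      ((N : ℝ) * q / (N - q)) ^ ((N : ℝ) * q / (N - q)) :=
    (Real.rpow_le_rpow (by linarith) hle (by linarith)).trans
      (Real.rpow_le_rpow_of_exponent_le (hp1.trans hle) hle)
  linarith [mul_le_mul_of_nonneg_right hconst hs]
end

section
/- Let K ⊂ ℝ^N (N ≥ 2) be a nonempty compact set, let p, q, r, s : K → ℝ be continuous functions with 1 < p(x) < q(x) < N, 1 < r(x) < p*(x) and 1 < s(x) < q*(x) for all x ∈ K, where p*(x) = Np(x)/(N−p(x)) and q*(x) = Nq(x)/(N−q(x)), and let μ : K → [0,∞) be any function. Then for every k > 0 and every ε > 0 there exists a constant C > 0 (depending only on k, ε, N and the exponent functions, not on μ) such that for all x ∈ K and all t ≥ 0: (k t)^{r(x)} + μ(x)^{s(x)/q(x)} (k t)^{s(x)} ≤ ε · (t^{p*(x)} + μ(x)^{q*(x)/q(x)} t^{q*(x)}) + C. -/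
/-- For continuous exponents `0 < a < b` on a compact set, the power `(k t) ^ a` is absorbed by
`ε t ^ b` up to a constant, uniformly over the set. -/
lemma IsCompact.exists_rpow_le_mul_rpow_add {X : Type*} [TopologicalSpace X] {K : Set X}
    (hK : IsCompact K) {a b : X → ℝ} (ha : ContinuousOn a K) (hb : ContinuousOn b K)
    (hab : ∀ x ∈ K, 0 < a x ∧ a x < b x) {k ε : ℝ} (hk : 0 < k) (hε : 0 < ε) :
    ∃ C : ℝ, 0 < C ∧ ∀ x ∈ K, ∀ t : ℝ, 0 ≤ t → (k * t) ^ a x ≤ ε * t ^ b x + C := by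
  have hcont : ContinuousOn (fun x => (k * (k ^ a x / ε) ^ (b x - a x)⁻¹) ^ a x) K := by
    have h_inv : ContinuousOn (fun x => (b x - a x)⁻¹) K :=
      (hb.sub ha).inv₀ fun x hx => (sub_pos.2 (hab x hx).2).ne'
    have h_base : ContinuousOn (fun x => k ^ a x / ε) K :=
      (continuousOn_const.rpow ha fun _ _ => Or.inl hk.ne').div_const ε
    exact (continuousOn_const.mul
      (h_base.rpow h_inv fun _ _ => Or.inl (by positivity))).rpow ha
        fun x hx => Or.inr (hab x hx).1
  obtain ⟨M, hM⟩ := hK.bddAbove_image hcont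
  refine ⟨max M 1, by positivity, fun x hx t ht => ?_⟩
  obtain ⟨ha0, hlt⟩ := hab x hx
  have hd : 0 < b x - a x := sub_pos.2 hlt
  rcases le_total t ((k ^ a x / ε) ^ (b x - a x)⁻¹) with h | h
  · calc (k * t) ^ a x ≤ (k * (k ^ a x / ε) ^ (b x - a x)⁻¹) ^ a x := by gcongr
      _ ≤ M := hM (Set.mem_image_of_mem _ hx)
      _ ≤ max M 1 := le_max_left _ _
      _ ≤ ε * t ^ b x + max M 1 := le_add_of_nonneg_left (by positivity)
  · have ht0 : 0 < t := lt_of_lt_of_le (by positivity) h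
    have hpow : k ^ a x / ε ≤ t ^ (b x - a x) :=
      (Real.rpow_inv_le_iff_of_pos (by positivity) ht hd).1 h
    calc (k * t) ^ a x = k ^ a x * t ^ a x := Real.mul_rpow hk.le ht
      _ ≤ (ε * t ^ (b x - a x)) * t ^ a x := by
        gcongr
        exact (div_le_iff₀' hε).1 hpow
      _ = ε * t ^ b x := by rw [mul_assoc, ← Real.rpow_add ht0, sub_add_cancel]
      _ ≤ ε * t ^ b x + max M 1 := le_add_of_nonneg_right (by positivity)

/-- Uniform absorption estimate: the subcritical double phase integrand increases
essentially slower than the critical one, uniformly in the weight `μ`. -/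
theorem stmt_12 (N : ℕ) (hN : 2 ≤ N) (K : Set (Fin N → ℝ))
    (hK : IsCompact K) (hKne : K.Nonempty)
    (p q r s : (Fin N → ℝ) → ℝ)
    (hp : ContinuousOn p K) (hq : ContinuousOn q K)
    (hr : ContinuousOn r K) (hs : ContinuousOn s K)
    (hcond : ∀ x ∈ K, 1 < p x ∧ p x < q x ∧ q x < (N : ℝ) ∧
      1 < r x ∧ r x < (N : ℝ) * p x / ((N : ℝ) - p x) ∧
      1 < s x ∧ s x < (N : ℝ) * q x / ((N : ℝ) - q x)) :
    ∀ k : ℝ, 0 < k → ∀ ε : ℝ, 0 < ε → ∃ C : ℝ, 0 < C ∧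
      ∀ μ : (Fin N → ℝ) → ℝ, (∀ x ∈ K, 0 ≤ μ x) →
        ∀ x ∈ K, ∀ t : ℝ, 0 ≤ t →
          (k * t) ^ r x + μ x ^ (s x / q x) * (k * t) ^ s x ≤
            ε * (t ^ ((N : ℝ) * p x / ((N : ℝ) - p x)) +
              μ x ^ (((N : ℝ) * q x / ((N : ℝ) - q x)) / q x) *
                t ^ ((N : ℝ) * q x / ((N : ℝ) - q x))) + C := by
  intro k hk ε hε
  have hp' : ContinuousOn (fun x => (N : ℝ) * p x / ((N : ℝ) - p x)) K :=
    (continuousOn_const.mul hp).div (continuousOn_const.sub hp) fun x hx => by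
      obtain ⟨-, h₁, h₂, -⟩ := hcond x hx
      exact (sub_pos.2 (h₁.trans h₂)).ne'
  have hq' : ContinuousOn (fun x => (N : ℝ) * q x / ((N : ℝ) - q x)) K :=
    (continuousOn_const.mul hq).div (continuousOn_const.sub hq) fun x hx =>
      (sub_pos.2 (hcond x hx).2.2.1).ne'
  obtain ⟨C₁, hC₁, h₁⟩ := hK.exists_rpow_le_mul_rpow_add hr hp'
    (fun x hx => ⟨zero_lt_one.trans (hcond x hx).2.2.2.1, (hcond x hx).2.2.2.2.1⟩) hk hε
  obtain ⟨C₂, hC₂, h₂⟩ := hK.exists_rpow_le_mul_rpow_add hs hq'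
    (fun x hx => ⟨zero_lt_one.trans (hcond x hx).2.2.2.2.2.1, (hcond x hx).2.2.2.2.2.2⟩) hk hε
  refine ⟨C₁ + C₂, add_pos hC₁ hC₂, fun μ hμ x hx t ht => ?_⟩
  have hμx := hμ x hx
  have hweight : ∀ c : ℝ, μ x ^ (c / q x) = (μ x ^ (q x)⁻¹) ^ c := fun c => by
    rw [← Real.rpow_mul hμx, div_eq_inv_mul]
  have hw : 0 ≤ μ x ^ (q x)⁻¹ := Real.rpow_nonneg hμx _
  have hrescaled := h₂ x hx (μ x ^ (q x)⁻¹ * t) (mul_nonneg hw ht)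
  rw [mul_left_comm, Real.mul_rpow hw (mul_nonneg hk.le ht), Real.mul_rpow hw ht] at hrescaled
  rw [hweight, hweight]
  linarith [h₁ x hx t ht]
end

section
/- Let N ≥ 2, let B be the open unit ball in ℝ^N, and let p, q, s be real constants with 1 < p < q < N and s > 0. Suppose there exists a constant C > 0 such that for every u ∈ C_c^∞(B): (∫_B |u|^s dx)^{1/s} ≤ C [ (∫_B |∇u|^p dx)^{1/p} + (∫_B |∇u|^q dx)^{1/q} ]. Then s ≤ Nq/(N−q). -/
open MeasureTheory

/-- The integral of a power of the norm of a dilated function, restricted to a set off which the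
dilated function vanishes. -/
lemma setIntegral_norm_rpow_comp_smul {N : ℕ} {F : Type*} [NormedAddCommGroup F]
    (g : (Fin N → ℝ) → F) {r : ℝ} (hr : 0 < r) {t : ℝ} (ht : 0 < t) {S : Set (Fin N → ℝ)}
    (hS : ∀ x, x ∉ S → g (t • x) = 0) :
    ∫ x in S, ‖g (t • x)‖ ^ r = t ^ (-(N : ℝ)) * ∫ x, ‖g x‖ ^ r := by
  rw [setIntegral_eq_integral_of_forall_compl_eq_zero
    (fun x hx => by rw [hS x hx, norm_zero, Real.zero_rpow hr.ne']),
    Measure.integral_comp_smul volume (fun x => ‖g x‖ ^ r) t, Module.finrank_fin_fun,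
    abs_of_pos (by positivity), smul_eq_mul, Real.rpow_neg ht.le, Real.rpow_natCast]

/-- The `L^r` norm of the gradient of a dilated function. -/
lemma gradient_rpow_comp_smul {N : ℕ} {f : (Fin N → ℝ) → ℝ} {r : ℝ} (hr : 0 < r) {t : ℝ}
    (ht : 0 < t) {S : Set (Fin N → ℝ)} (hS : ∀ x, x ∉ S → fderiv ℝ f (t • x) = 0) :
    (∫ x in S, ‖fderiv ℝ (fun y => f (t • y)) x‖ ^ r) ^ (1 / r) =
      t ^ (1 - N / r) * (∫ x, ‖fderiv ℝ f x‖ ^ r) ^ (1 / r) := by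
  have h (x : Fin N → ℝ) : ‖fderiv ℝ (fun y => f (t • y)) x‖ ^ r =
      t ^ r * ‖fderiv ℝ f (t • x)‖ ^ r := by
    rw [fderiv_comp_smul, norm_smul, Real.norm_of_nonneg ht.le,
      Real.mul_rpow ht.le (norm_nonneg _)]
  simp_rw [h]
  rw [integral_const_mul, setIntegral_norm_rpow_comp_smul _ hr ht hS, ← mul_assoc,
    ← Real.rpow_add ht, Real.mul_rpow (by positivity) (integral_nonneg fun x => by positivity),
    ← Real.rpow_mul ht.le]
  congr 2
  field_simp
  ring

/-- A power of `t` that is bounded for `t ≥ 1` has nonpositive exponent. -/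
lemma nonpos_of_rpow_le {a K : ℝ} (h : ∀ t : ℝ, 1 ≤ t → t ^ a ≤ K) : a ≤ 0 := by
  by_contra! ha
  obtain ⟨t, ht, ht1⟩ := (((tendsto_rpow_atTop ha).eventually_gt_atTop K).and
    (Filter.eventually_ge_atTop 1)).exists
  exact (h t ht1).not_gt ht

/-- Optimality of the exponent `q* = Nq/(N-q)` in the double phase Sobolev embedding with
weight `μ ≡ 1`. -/
theorem stmt_13 (N : ℕ) (hN : 2 ≤ N) (p q s : ℝ)
    (hp : 1 < p) (hpq : p < q) (hqN : q < (N : ℝ)) (hs : 0 < s)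
    (C : ℝ) (hC : 0 < C)
    (hineq : ∀ u : (Fin N → ℝ) → ℝ, ContDiff ℝ (⊤ : ℕ∞) u → HasCompactSupport u →
      tsupport u ⊆ Metric.ball (0 : Fin N → ℝ) 1 →
      (∫ x in Metric.ball (0 : Fin N → ℝ) 1, |u x| ^ s) ^ (1 / s) ≤
        C * ((∫ x in Metric.ball (0 : Fin N → ℝ) 1, ‖fderiv ℝ u x‖ ^ p) ^ (1 / p) +
             (∫ x in Metric.ball (0 : Fin N → ℝ) 1, ‖fderiv ℝ u x‖ ^ q) ^ (1 / q))) :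
    s ≤ (N : ℝ) * q / ((N : ℝ) - q) := by
  have hp0 : 0 < p := by linarith
  have hq0 : 0 < q := by linarith
  let f : ContDiffBump (0 : Fin N → ℝ) := ⟨1 / 4, 1 / 2, by norm_num, by norm_num⟩
  have hf : ContDiff ℝ (⊤ : ℕ∞) (f : (Fin N → ℝ) → ℝ) := f.contDiff
  have hA : 0 < (∫ x, ‖f x‖ ^ s) ^ (1 / s) := by
    refine Real.rpow_pos_of_pos ?_ _
    refine Continuous.integral_pos_of_hasCompactSupport_nonneg_nonzero (x := 0)
      (f.continuous.norm.rpow_const fun _ => Or.inr hs.le) ?_ (fun x => by positivity) ?_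
    · exact f.hasCompactSupport.comp_left (g := fun y : ℝ => ‖y‖ ^ s) (by simp [hs.ne'])
    · rw [f.one_of_mem_closedBall (Metric.mem_closedBall_self f.rIn_pos.le)]
      simp
  set A := (∫ x, ‖f x‖ ^ s) ^ (1 / s)
  set P := (∫ x, ‖fderiv ℝ f x‖ ^ p) ^ (1 / p)
  set Q := (∫ x, ‖fderiv ℝ f x‖ ^ q) ^ (1 / q)
  have hP : 0 ≤ P := Real.rpow_nonneg (integral_nonneg fun x => by positivity) _
  have key : ∀ t : ℝ, 1 ≤ t → t ^ (N / q - 1 - N / s) ≤ C * (P + Q) / A := by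
    intro t ht
    have ht0 : 0 < t := by linarith
    have hnot : ∀ x : Fin N → ℝ, x ∉ Metric.ball (0 : Fin N → ℝ) 1 → t • x ∉ tsupport f := by
      intro x hx
      rw [f.tsupport_eq]
      simp only [Metric.mem_ball, Metric.mem_closedBall, dist_zero_right, not_lt, not_le,
        norm_smul, Real.norm_of_nonneg ht0.le] at hx ⊢
      change 1 / 2 < _
      nlinarith
    have hu := hineq (fun y => f (t • y)) (hf.comp (contDiff_const_smul t))
      (f.hasCompactSupport.comp_homeomorph (Homeomorph.smulOfNeZero t ht0.ne')) (by
        intro x hx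
        by_contra hxS
        exact hnot x hxS (tsupport_comp_subset_preimage f (continuous_const_smul t) hx))
    have hfd : ∀ x : Fin N → ℝ, x ∉ Metric.ball (0 : Fin N → ℝ) 1 → fderiv ℝ f (t • x) = 0 :=
      fun x hx => image_eq_zero_of_notMem_tsupport
        fun h => hnot x hx (tsupport_fderiv_subset ℝ h)
    rw [gradient_rpow_comp_smul hp0 ht0 hfd, gradient_rpow_comp_smul hq0 ht0 hfd] at hu
    simp_rw [← Real.norm_eq_abs] at hu
    rw [setIntegral_norm_rpow_comp_smul _ hs ht0
      (fun x hx => image_eq_zero_of_notMem_tsupport (hnot x hx)),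
      Real.mul_rpow (by positivity) (integral_nonneg fun x => by positivity),
      ← Real.rpow_mul ht0.le] at hu
    change t ^ (-(N : ℝ) * (1 / s)) * A ≤ C * (t ^ (1 - N / p) * P + t ^ (1 - N / q) * Q) at hu
    have hexp : t ^ (1 - N / p) ≤ t ^ (1 - N / q) := by
      apply Real.rpow_le_rpow_of_exponent_le ht
      gcongr
    have hle : t ^ (-(N : ℝ) * (1 / s)) * A ≤ t ^ (1 - N / q) * (C * (P + Q)) :=
      calc _ ≤ C * (t ^ (1 - N / p) * P + t ^ (1 - N / q) * Q) := hu
        _ ≤ C * (t ^ (1 - N / q) * P + t ^ (1 - N / q) * Q) := by gcongr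
        _ = _ := by ring
    rw [le_div_iff₀ hA, show N / q - 1 - N / s = -(N : ℝ) * (1 / s) - (1 - N / q) by ring,
      Real.rpow_sub ht0, div_mul_eq_mul_div, div_le_iff₀ (by positivity)]
    linarith
  have h := nonpos_of_rpow_le key
  rw [le_div_iff₀ (by linarith)]
  field_simp at h
  linarith
end

section
/- Let N ≥ 2, let B be the open unit ball in ℝ^N, and let p, q, r be real constants with 1 < p < q < N, q/p < 1 + 1/N and r > 0. Suppose there exists a constant C > 0 such that for every u ∈ C_c^∞(B): (∫_B |u|^r dx)^{1/r} ≤ C [ (∫_B |∇u|^p dx)^{1/p} + (∫_B |x| · |∇u|^q dx)^{1/q} ]. Then r ≤ Np/(N−p). -/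
open MeasureTheory

open Filter Topology

/-- Integrals of functions supported in the unit ball, after dilation. -/
lemma setIntegral_ball_comp_smul {N : ℕ} (f : (Fin N → ℝ) → ℝ)
    (hf : ∀ x, 1 ≤ ‖x‖ → f x = 0) {t : ℝ} (ht : 1 ≤ t) :
    ∫ x in Metric.ball (0 : Fin N → ℝ) 1, f (t • x) = t ^ (-(N : ℝ)) * ∫ x, f x := by
  have ht0 : 0 < t := by linarith
  rw [setIntegral_eq_integral_of_forall_compl_eq_zero, Measure.integral_comp_smul]
  · simp [abs_of_pos ht0, Real.rpow_neg ht0.le]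
  · intro x hx
    have hx : 1 ≤ ‖x‖ := by simpa using hx
    apply hf
    rw [norm_smul, Real.norm_of_nonneg ht0.le]
    nlinarith

/-- Optimality of the exponent `p* = Np/(N-p)` in the double phase Sobolev embedding with
weight `μ(x) = |x|`. -/
theorem stmt_14 (N : ℕ) (hN : 2 ≤ N) (p q r : ℝ)
    (hp : 1 < p) (hpq : p < q) (hqN : q < (N : ℝ)) (hqp : q / p < 1 + 1 / (N : ℝ))
    (hr : 0 < r) (C : ℝ) (hC : 0 < C)
    (hineq : ∀ u : (Fin N → ℝ) → ℝ, ContDiff ℝ (⊤ : ℕ∞) u → HasCompactSupport u →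
      tsupport u ⊆ Metric.ball (0 : Fin N → ℝ) 1 →
      (∫ x in Metric.ball (0 : Fin N → ℝ) 1, |u x| ^ r) ^ (1 / r) ≤
        C * ((∫ x in Metric.ball (0 : Fin N → ℝ) 1, ‖fderiv ℝ u x‖ ^ p) ^ (1 / p) +
             (∫ x in Metric.ball (0 : Fin N → ℝ) 1, ‖x‖ * ‖fderiv ℝ u x‖ ^ q) ^ (1 / q))) :
    r ≤ (N : ℝ) * p / ((N : ℝ) - p) := by
  by_contra! hcon
  have hp0 : 0 < p := by linarith
  have hq0 : 0 < q := by linarith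
  have hN0 : (0 : ℝ) < N := by linarith
  have hNp : 0 < (N : ℝ) - p := by linarith
  have hexp₁ : 1 - N / p + N / r < 0 := by
    rw [div_lt_iff₀ hNp] at hcon
    have : 1 - N / p + N / r = (p * r - N * r + N * p) / (p * r) := by field_simp
    rw [this]
    exact div_neg_of_neg_of_pos (by linarith) (by positivity)
  have hexp₂ : 1 - (N + 1) / q + N / r < 0 := by
    have : (N : ℝ) / p < (N + 1) / q := by
      rw [div_lt_div_iff₀ hp0 hq0]
      rw [div_lt_iff₀ hp0] at hqp
      calc (N : ℝ) * q < N * ((1 + 1 / N) * p) := by gcongr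
        _ = (N + 1) * p := by field_simp
    linarith
  let φ : ContDiffBump (0 : Fin N → ℝ) := ⟨1 / 4, 1 / 2, by norm_num, by norm_num⟩
  have hφ : ContDiff ℝ (⊤ : ℕ∞) φ := φ.contDiff
  have hrOut : φ.rOut = 1 / 2 := rfl
  have hφ0 : ∀ x, 1 / 2 ≤ ‖x‖ → φ x = 0 := fun x hx => φ.zero_of_le_dist (by simpa [hrOut] using hx)
  have hdφ0 : ∀ x, 1 ≤ ‖x‖ → fderiv ℝ φ x = 0 := by
    intro x hx
    by_contra h
    have := support_fderiv_subset ℝ (Function.mem_support.2 h)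
    rw [φ.tsupport_eq, hrOut] at this
    have : ‖x‖ ≤ 1 / 2 := by simpa using this
    linarith
  set A := ∫ x, |φ x| ^ r
  set a := ∫ x, ‖fderiv ℝ φ x‖ ^ p
  set b := ∫ x, ‖x‖ * ‖fderiv ℝ φ x‖ ^ q
  have hA : 0 < A := by
    apply Continuous.integral_pos_of_hasCompactSupport_nonneg_nonzero (x := 0)
    · exact φ.continuous.abs.rpow_const fun _ => Or.inr hr.le
    · exact φ.hasCompactSupport.comp_left (g := fun y : ℝ => |y| ^ r) (by simp [hr.ne'])
    · intro x
      positivity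
    · have : φ 0 = 1 := φ.one_of_mem_closedBall (Metric.mem_closedBall_self φ.rIn_pos.le)
      simp [this]
  have ha : 0 ≤ a := integral_nonneg fun x => by positivity
  have hb : 0 ≤ b := integral_nonneg fun x => by positivity
  have key : ∀ t : ℝ, 1 ≤ t → A ^ (1 / r) ≤
      C * (a ^ (1 / p) * t ^ (1 - N / p + N / r) +
        b ^ (1 / q) * t ^ (1 - (N + 1) / q + N / r)) := by
    intro t ht
    have ht0 : 0 < t := by linarith
    have hu0 : Function.support (fun x => φ (t • x)) ⊆ Metric.closedBall 0 (1 / 2) := by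
      intro x hx
      by_contra h
      have h : 1 / 2 < ‖x‖ := by simpa using h
      refine hx (hφ0 _ ?_)
      rw [norm_smul, Real.norm_of_nonneg ht0.le]
      nlinarith
    have h := hineq (fun x => φ (t • x)) (hφ.comp (contDiff_const_smul t))
      (HasCompactSupport.of_support_subset_isCompact (isCompact_closedBall _ _) hu0)
      ((closure_minimal hu0 Metric.isClosed_closedBall).trans
        (Metric.closedBall_subset_ball (by norm_num)))
    have hd : ∀ x, ‖fderiv ℝ (fun x => φ (t • x)) x‖ = t * ‖fderiv ℝ φ (t • x)‖ := by
      intro x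
      rw [fderiv_comp_smul, norm_smul, Real.norm_of_nonneg ht0.le]
    have e₁ : ∫ x in Metric.ball (0 : Fin N → ℝ) 1, |φ (t • x)| ^ r = t ^ (-(N : ℝ)) * A :=
      setIntegral_ball_comp_smul (fun x => |φ x| ^ r)
        (fun x hx => by simp [hφ0 x (by linarith), hr.ne']) ht
    have e₂ : ∫ x in Metric.ball (0 : Fin N → ℝ) 1,
        ‖fderiv ℝ (fun x => φ (t • x)) x‖ ^ p = t ^ (p - N) * a := by
      have := setIntegral_ball_comp_smul (fun x => ‖fderiv ℝ φ x‖ ^ p)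
        (fun x hx => by simp [hdφ0 x hx, hp0.ne']) ht
      simp_rw [hd, Real.mul_rpow ht0.le (norm_nonneg _)]
      rw [integral_const_mul, this, ← mul_assoc, ← Real.rpow_add ht0, ← sub_eq_add_neg]
    have e₃ : ∫ x in Metric.ball (0 : Fin N → ℝ) 1,
        ‖x‖ * ‖fderiv ℝ (fun x => φ (t • x)) x‖ ^ q = t ^ (q - (N + 1)) * b := by
      have := setIntegral_ball_comp_smul (fun x => ‖x‖ * ‖fderiv ℝ φ x‖ ^ q)
        (fun x hx => by simp [hdφ0 x hx, hq0.ne']) ht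
      have hx : ∀ x : Fin N → ℝ, ‖x‖ * ‖fderiv ℝ (fun x => φ (t • x)) x‖ ^ q =
          t ^ (q - 1) * (‖t • x‖ * ‖fderiv ℝ φ (t • x)‖ ^ q) := by
        intro x
        rw [hd, Real.mul_rpow ht0.le (norm_nonneg _), norm_smul, Real.norm_of_nonneg ht0.le,
          Real.rpow_sub_one ht0.ne']
        field_simp
      simp_rw [hx]
      rw [integral_const_mul, this, ← mul_assoc, ← Real.rpow_add ht0]
      congr 2
      ring
    rw [e₁, e₂, e₃, Real.mul_rpow (by positivity) hA.le, Real.mul_rpow (by positivity) ha,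
      Real.mul_rpow (by positivity) hb, ← Real.rpow_mul ht0.le, ← Real.rpow_mul ht0.le,
      ← Real.rpow_mul ht0.le] at h
    have h' := mul_le_mul_of_nonneg_left h (Real.rpow_nonneg ht0.le (N / r))
    have m₁ : t ^ ((N : ℝ) / r) * t ^ (-(N : ℝ) * (1 / r)) = 1 := by
      rw [← Real.rpow_add ht0, show (N : ℝ) / r + -(N : ℝ) * (1 / r) = 0 by ring, Real.rpow_zero]
    have m₂ : t ^ (1 - N / p + N / r) = t ^ ((N : ℝ) / r) * t ^ ((p - N) * (1 / p)) := by
      rw [← Real.rpow_add ht0]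
      congr 1
      field_simp
      ring
    have m₃ : t ^ (1 - (N + 1) / q + N / r) =
        t ^ ((N : ℝ) / r) * t ^ ((q - (N + 1)) * (1 / q)) := by
      rw [← Real.rpow_add ht0]
      congr 1
      field_simp
      ring
    rw [← mul_assoc, m₁, one_mul] at h'
    rw [m₂, m₃]
    linarith
  have hpow : ∀ s : ℝ, s < 0 → Tendsto (fun t : ℝ => t ^ s) atTop (𝓝 0) := fun s hs => by
    simpa using tendsto_rpow_neg_atTop (neg_pos.2 hs)
  have hlim := (((hpow _ hexp₁).const_mul (a ^ (1 / p))).add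
    ((hpow _ hexp₂).const_mul (b ^ (1 / q)))).const_mul C
  have hle := ge_of_tendsto hlim ((eventually_ge_atTop 1).mono key)
  have : 0 < A ^ (1 / r) := Real.rpow_pos_of_pos hA _
  simp only [mul_zero, add_zero] at hle
  linarith
end

section
/- Let N ≥ 2, let B be the open unit ball in ℝ^N, and let p, q, s, α be real constants with 1 < p < q < N, q/p < 1 + 1/N, s > 0 and α > 0. Suppose there exists a constant C > 0 such that for every u ∈ C_c^∞(B): (∫_B |x|^α |u|^s dx)^{1/s} ≤ C [ (∫_B |∇u|^p dx)^{1/p} + (∫_B |x| · |∇u|^q dx)^{1/q} ]. Then α + N ≥ s(N−p)/p. -/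
open MeasureTheory

/-- If `A * t ^ (-a)` is bounded by `K * t ^ (-b)` for all `t ≥ 1` and `A > 0`, then `b ≤ a`. -/
theorem le_of_forall_mul_rpow_neg_le {A K a b : ℝ} (hA : 0 < A)
    (h : ∀ t : ℝ, 1 ≤ t → A * t ^ (-a) ≤ K * t ^ (-b)) : b ≤ a := by
  by_contra! hab
  have ht := (tendsto_rpow_atTop (sub_pos.2 hab)).const_mul_atTop hA
  obtain ⟨t, htK, ht1⟩ :=
    ((ht.eventually_gt_atTop K).and (Filter.eventually_ge_atTop 1)).exists
  have ht0 : 0 < t := by linarith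
  have h1 := mul_le_mul_of_nonneg_right (h t ht1) (Real.rpow_nonneg ht0.le b)
  rw [mul_assoc, mul_assoc, ← Real.rpow_add ht0, ← Real.rpow_add ht0, neg_add_cancel,
    Real.rpow_zero, mul_one, neg_add_eq_sub] at h1
  linarith

/-- Scaling of the integral of a function that is homogeneous under dilations up to a power. -/
theorem integral_rpow_eq_of_dilation {N : ℕ} (F G : (Fin N → ℝ) → ℝ) {t β r : ℝ} (ht : 0 < t)
    (hF : 0 ≤ ∫ x, F x) (h : ∀ x, G x = t ^ β * F (t • x)) :
    (∫ x, G x) ^ (1 / r) = t ^ ((β - N) / r) * (∫ x, F x) ^ (1 / r) := by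
  have hN : |(t ^ N)⁻¹| = t ^ (-(N : ℝ)) := by
    rw [abs_of_pos (by positivity), Real.rpow_neg ht.le, Real.rpow_natCast]
  simp only [h]
  rw [integral_const_mul, Measure.integral_comp_smul, Module.finrank_fin_fun, hN, smul_eq_mul,
    ← mul_assoc, ← Real.rpow_add ht, Real.mul_rpow (by positivity) hF, ← Real.rpow_mul ht.le]
  ring_nf

/-- Optimality of the weight exponent in the critical double phase embedding with weight
`μ(x) = |x|`: a weighted embedding forces `α + N ≥ s(N-p)/p`. -/
theorem stmt_15 (N : ℕ) (hN : 2 ≤ N) (p q s α : ℝ)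
    (hp : 1 < p) (hpq : p < q) (hqN : q < (N : ℝ)) (hqp : q / p < 1 + 1 / (N : ℝ))
    (hs : 0 < s) (hα : 0 < α) (C : ℝ) (hC : 0 < C)
    (hineq : ∀ u : (Fin N → ℝ) → ℝ, ContDiff ℝ (⊤ : ℕ∞) u → HasCompactSupport u →
      tsupport u ⊆ Metric.ball (0 : Fin N → ℝ) 1 →
      (∫ x in Metric.ball (0 : Fin N → ℝ) 1, ‖x‖ ^ α * |u x| ^ s) ^ (1 / s) ≤
        C * ((∫ x in Metric.ball (0 : Fin N → ℝ) 1, ‖fderiv ℝ u x‖ ^ p) ^ (1 / p) +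
             (∫ x in Metric.ball (0 : Fin N → ℝ) 1, ‖x‖ * ‖fderiv ℝ u x‖ ^ q) ^ (1 / q))) :
    s * ((N : ℝ) - p) / p ≤ α + (N : ℝ) := by
  have hp0 : 0 < p := by linarith
  have hq0 : 0 < q := by linarith
  have hN0 : (0 : ℝ) < N := by linarith
  have : Nonempty (Fin N) := ⟨⟨0, by omega⟩⟩
  let φ : ContDiffBump (0 : Fin N → ℝ) := ⟨1 / 4, 1 / 2, by norm_num, by norm_num⟩
  have hφout : φ.rOut = 1 / 2 := rfl
  have hφin : φ.rIn = 1 / 4 := rfl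
  set A := ∫ x : Fin N → ℝ, ‖x‖ ^ α * |φ x| ^ s with hAdef
  set D := ∫ x : Fin N → ℝ, ‖fderiv ℝ φ x‖ ^ p with hDdef
  set E := ∫ x : Fin N → ℝ, ‖x‖ * ‖fderiv ℝ φ x‖ ^ q with hEdef
  have hA : 0 < A := by
    have hcont : Continuous fun x : Fin N → ℝ => ‖x‖ ^ α * |φ x| ^ s :=
      (continuous_norm.rpow_const fun _ => Or.inr hα.le).mul
        (φ.continuous.abs.rpow_const fun _ => Or.inr hs.le)
    refine hcont.integral_pos_of_hasCompactSupport_nonneg_nonzero (x := fun _ => 1 / 8) ?_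
      (fun x => by positivity) ?_
    · refine φ.hasCompactSupport.mono fun x hx => ?_
      contrapose! hx
      rw [Function.notMem_support] at hx ⊢
      simp [hx, hs.ne']
    · have hn : ‖(fun _ => 1 / 8 : Fin N → ℝ)‖ = 1 / 8 := by
        rw [pi_norm_const]; norm_num
      have h1 : φ (fun _ => 1 / 8 : Fin N → ℝ) = 1 := by
        apply φ.one_of_mem_closedBall
        rw [mem_closedBall_zero_iff, hn, hφin]
        norm_num
      rw [h1, hn]
      simp only [abs_one, Real.one_rpow, mul_one]
      positivity
  have hD : 0 ≤ D := integral_nonneg fun x => by positivity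
  have hE : 0 ≤ E := integral_nonneg fun x => by positivity
  have hexp : (q - 1 - N) / q ≤ -((N - p) / p) := by
    rw [← neg_div, div_le_div_iff₀ hq0 hp0]
    rw [div_lt_iff₀ hp0] at hqp
    have : q * N < p * (N + 1) := by
      calc q * N < (1 + 1 / (N : ℝ)) * p * N := by gcongr
        _ = p * (N + 1) := by field_simp
    nlinarith
  have key : ∀ t : ℝ, 1 ≤ t → A ^ (1 / s) * t ^ (-((α + N) / s)) ≤
      (C * (D ^ (1 / p) + E ^ (1 / q))) * t ^ (-((N - p) / p)) := by
    intro t ht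
    have ht0 : 0 < t := by linarith
    let u : (Fin N → ℝ) → ℝ := fun x => φ (t • x)
    have hu : ContDiff ℝ (⊤ : ℕ∞) u := φ.contDiff.comp (contDiff_const_smul t)
    have hsub : tsupport u ⊆ Metric.closedBall 0 (1 / 2) := by
      refine closure_minimal (fun x hx => ?_) Metric.isClosed_closedBall
      have h1 : t • x ∈ Function.support φ := hx
      rw [φ.support_eq, mem_ball_zero_iff, norm_smul, Real.norm_of_nonneg ht0.le, hφout] at h1
      rw [mem_closedBall_zero_iff]
      nlinarith [norm_nonneg x]
    have hcs : HasCompactSupport u :=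
      (isCompact_closedBall _ _).of_isClosed_subset (isClosed_tsupport u) hsub
    have hball : tsupport u ⊆ Metric.ball 0 1 :=
      hsub.trans (Metric.closedBall_subset_ball (by norm_num))
    have hu0 : ∀ x, x ∉ Metric.ball (0 : Fin N → ℝ) 1 → u x = 0 := fun x hx =>
      image_eq_zero_of_notMem_tsupport fun h => hx (hball h)
    have hdu0 : ∀ x, x ∉ Metric.ball (0 : Fin N → ℝ) 1 → fderiv ℝ u x = 0 := fun x hx =>
      Function.notMem_support.1 fun h => hx (hball (support_fderiv_subset ℝ h))
    have hdu : ∀ x, ‖fderiv ℝ u x‖ = t * ‖fderiv ℝ φ (t • x)‖ := fun x => by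
      rw [show fderiv ℝ u x = t • fderiv ℝ φ (t • x) from fderiv_comp_smul t, norm_smul,
        Real.norm_of_nonneg ht0.le]
    have hmain := hineq u hu hcs hball
    rw [setIntegral_eq_integral_of_forall_compl_eq_zero
        (fun x hx => by simp [hu0 x hx, hs.ne']),
      setIntegral_eq_integral_of_forall_compl_eq_zero
        (fun x hx => by simp [hdu0 x hx, hp0.ne']),
      setIntegral_eq_integral_of_forall_compl_eq_zero
        (fun x hx => by simp [hdu0 x hx, hq0.ne']),
      integral_rpow_eq_of_dilation (fun x => ‖x‖ ^ α * |φ x| ^ s) (fun x => ‖x‖ ^ α * |u x| ^ s)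
        (β := -α) ht0 hA.le
        (fun x => by
          rw [norm_smul, Real.norm_of_nonneg ht0.le, Real.mul_rpow ht0.le (norm_nonneg x),
            ← mul_assoc, ← mul_assoc, ← Real.rpow_add ht0, neg_add_cancel, Real.rpow_zero,
            one_mul]),
      integral_rpow_eq_of_dilation (fun x => ‖fderiv ℝ φ x‖ ^ p) (fun x => ‖fderiv ℝ u x‖ ^ p) (β := p) ht0 hD
        (fun x => by rw [hdu, Real.mul_rpow ht0.le (norm_nonneg _)]),
      integral_rpow_eq_of_dilation (fun x => ‖x‖ * ‖fderiv ℝ φ x‖ ^ q)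
        (fun x => ‖x‖ * ‖fderiv ℝ u x‖ ^ q) (β := q - 1) ht0 hE
        (fun x => by
          rw [hdu, Real.mul_rpow ht0.le (norm_nonneg _), norm_smul, Real.norm_of_nonneg ht0.le,
            Real.rpow_sub_one ht0.ne']
          field_simp),
      ← hAdef, ← hDdef, ← hEdef] at hmain
    have hle : t ^ ((q - 1 - N) / q) ≤ t ^ (-((N - p) / p)) :=
      Real.rpow_le_rpow_of_exponent_le ht hexp
    calc A ^ (1 / s) * t ^ (-((α + N) / s)) = t ^ ((-α - N) / s) * A ^ (1 / s) := by ring_nf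
      _ ≤ _ := hmain
      _ ≤ C * (t ^ (-((N - p) / p)) * D ^ (1 / p) + t ^ (-((N - p) / p)) * E ^ (1 / q)) := by
        rw [show (p - N) / p = -((N - p) / p) by ring]
        gcongr
      _ = _ := by ring
  have hfin := le_of_forall_mul_rpow_neg_le (Real.rpow_pos_of_pos hA _) key
  rw [le_div_iff₀ hs] at hfin
  calc s * ((N : ℝ) - p) / p = ((N : ℝ) - p) / p * s := by ring
    _ ≤ _ := hfin
end
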